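/- The pebbling number of the 4-dimensional hypercube Q_4 equals 16. -/

import Mathlib

open SimpleGraph Finset

def PebMove {V : Type*} [DecidableEq V] (G : SimpleGraph V) (p q : V → ℕ) : Prop :=
  ∃ u v, G.Adj u v ∧ 2 ≤ p u ∧
    q = fun x => if x = u then p u - 2 else if x = v then p v + 1 else p x

def Solvable {V : Type*} [DecidableEq V] (G : SimpleGraph V) (r : V) (p : V → ℕ) : Prop :=
  ∃ q, Relation.ReflTransGen (PebMove G) p q ∧ 1 ≤ q r

noncomputable def confWeight {V : Type*} [Fintype V] (w : V → ℝ) (p : V → ℕ) : ℝ :=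
  ∑ v, (p v : ℝ) * w v

def ValidWeight {V : Type*} [Fintype V] [DecidableEq V] (G : SimpleGraph V) (r : V)
    (w : V → ℝ) : Prop :=
  w r = 0 ∧ (∀ v, v ≠ r → 0 < w v) ∧
    ∀ p : V → ℕ, ¬ Solvable G r p → confWeight w p ≤ confWeight w (fun _ => 1)

noncomputable def rootedPebblingNumber {V : Type*} [Fintype V] [DecidableEq V]
    (G : SimpleGraph V) (r : V) : ℕ :=
  sInf {N | ∀ p : V → ℕ, N ≤ ∑ v, p v → Solvable G r p}

noncomputable def pebblingNumber {V : Type*} [Fintype V] [DecidableEq V]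
    (G : SimpleGraph V) : ℕ :=
  sInf {N | ∀ (r : V) (p : V → ℕ), N ≤ ∑ v, p v → Solvable G r p}

def cubeGraph (n : ℕ) : SimpleGraph (Fin n → Bool) :=
  SimpleGraph.fromRel (fun x y => hammingDist x y = 1)

def addPendant {V : Type*} (G : SimpleGraph V) (a : V) : SimpleGraph (Option V) :=
  SimpleGraph.fromRel (fun x y =>
    match x, y with
    | some u, some v => G.Adj u v
    | none, some u => u = a
    | _, _ => False)

def lollipop (n m : ℕ) : SimpleGraph (Fin (n + 1) ⊕ Fin (m + 1)) :=
  SimpleGraph.fromRel (fun x y =>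
    match x, y with
    | Sum.inl i, Sum.inl j => (i : ℕ) + 1 = (j : ℕ)
    | Sum.inl i, Sum.inr j => i = 0 ∧ j ≠ 0
    | Sum.inr i, Sum.inr j => i = 0 ∧ j ≠ 0
    | _, _ => False)

/-- Adjacency in the cube is Hamming distance one. -/
theorem cube_adj {n : ℕ} (u v : Fin n → Bool) :
    (cubeGraph n).Adj u v ↔ hammingDist u v = 1 := by
  unfold cubeGraph
  rw [SimpleGraph.fromRel_adj, hammingDist_comm v u, or_self]
  constructor
  · exact fun h => h.2
  · intro h
    refine ⟨?_, h⟩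
    rintro rfl
    simp at h

theorem hamming_cons {n : ℕ} (s t : Bool) (u v : Fin n → Bool) :
    hammingDist (Fin.cons s u : Fin (n+1) → Bool) (Fin.cons t v : Fin (n+1) → Bool)
      = (if s = t then 0 else 1) + hammingDist u v := by
  unfold hammingDist
  rw [Fin.card_filter_univ_succ]
  by_cases h : s = t
  · simp [h]
  · simp [h]; omega

/-- Join configurations on the two halves of the cube: `a` on the half `x 0 = s`. -/
def joinConf {n : ℕ} (s : Bool) (a b : (Fin n → Bool) → ℕ) : (Fin (n+1) → Bool) → ℕ :=
  fun x => if x 0 = s then a (Fin.tail x) else b (Fin.tail x)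

theorem joinConf_swap {n : ℕ} (s : Bool) (a b : (Fin n → Bool) → ℕ) :
    joinConf s a b = joinConf (!s) b a := by
  funext x
  unfold joinConf
  cases s <;> cases x 0 <;> simp

theorem joinConf_split {n : ℕ} (s : Bool) (c : (Fin (n+1) → Bool) → ℕ) :
    c = joinConf s (fun u => c (Fin.cons s u)) (fun u => c (Fin.cons (!s) u)) := by
  funext x
  unfold joinConf
  by_cases h : x 0 = s
  · subst h; simp
  · have h2 : x 0 = !s := by cases s <;> cases hx : x 0 <;> simp_all
    rw [if_neg h, ← h2]; simp

theorem sum_split {n : ℕ} (s : Bool) (c : (Fin (n+1) → Bool) → ℕ) :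
    ∑ x, c x = ∑ u, c (Fin.cons s u) + ∑ u, c (Fin.cons (!s) u) := by
  rw [← (Fin.consEquiv (fun _ : Fin (n+1) => Bool)).sum_comp c, Fintype.sum_prod_type]
  cases s <;> simp [Fin.consEquiv, add_comm]

abbrev Reach (n : ℕ) (p q : (Fin n → Bool) → ℕ) : Prop :=
  Relation.ReflTransGen (PebMove (cubeGraph n)) p q

theorem move_left {n : ℕ} (s : Bool) {a a' : (Fin n → Bool) → ℕ} (b : (Fin n → Bool) → ℕ)
    (h : PebMove (cubeGraph n) a a') :
    PebMove (cubeGraph (n+1)) (joinConf s a b) (joinConf s a' b) := by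
  obtain ⟨u, v, huv, h2, rfl⟩ := h
  refine ⟨Fin.cons s u, Fin.cons s v, ?_, ?_, ?_⟩
  · rw [cube_adj] at *
    rw [hamming_cons]; simpa using huv
  · simpa [joinConf] using h2
  · funext x
    induction x using Fin.consCases with
    | _ t y =>
    by_cases h : t = s
    · subst h; simp [joinConf, Fin.cons_inj]
    · simp [joinConf, Fin.cons_inj, h]

theorem reach_left {n : ℕ} (s : Bool) {a a' : (Fin n → Bool) → ℕ} (b : (Fin n → Bool) → ℕ)
    (h : Reach n a a') : Reach (n+1) (joinConf s a b) (joinConf s a' b) :=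
  Relation.ReflTransGen.lift (fun a => joinConf s a b) (fun _ _ h => move_left s b h) _ _ h

theorem reach_right {n : ℕ} (s : Bool) (a : (Fin n → Bool) → ℕ) {b b' : (Fin n → Bool) → ℕ}
    (h : Reach n b b') : Reach (n+1) (joinConf s a b) (joinConf s a b') := by
  rw [joinConf_swap s a b, joinConf_swap s a b']
  exact reach_left _ _ h

theorem move_cross {n : ℕ} (s : Bool) (a b : (Fin n → Bool) → ℕ) (v : Fin n → Bool)
    (h : 2 ≤ b v) :
    PebMove (cubeGraph (n+1)) (joinConf s a b)
      (joinConf s (Function.update a v (a v + 1)) (Function.update b v (b v - 2))) := by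
  refine ⟨Fin.cons (!s) v, Fin.cons s v, ?_, ?_, ?_⟩
  · rw [cube_adj, hamming_cons]; simp
  · simpa [joinConf] using h
  · funext x
    induction x using Fin.consCases with
    | _ t y =>
    by_cases h : t = s
    · subst h; simp [joinConf, Fin.cons_inj, Function.update_apply]
    · have h2 : t = !s := by cases s <;> cases t <;> simp_all
      subst h2
      simp [joinConf, Fin.cons_inj, Function.update_apply]

theorem sum_upd {n : ℕ} (f g : (Fin n → Bool) → ℕ) (v : Fin n → Bool)
    (h : ∀ x, x ≠ v → f x = g x) : ∑ x, f x + g v = ∑ x, g x + f v := by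
  have e : ∑ x ∈ univ.erase v, f x = ∑ x ∈ univ.erase v, g x :=
    Finset.sum_congr rfl (fun x hx => h x (Finset.ne_of_mem_erase hx))
  have h1 := Finset.sum_erase_add univ f (Finset.mem_univ v)
  have h2 := Finset.sum_erase_add univ g (Finset.mem_univ v)
  omega

/-- Transfer `k` pebbles across, keeping parities on the source side. -/
theorem transfer {n : ℕ} (s : Bool) (k : ℕ) : ∀ (a b : (Fin n → Bool) → ℕ),
    2 * k + ∑ v, b v % 2 ≤ ∑ v, b v →
    ∃ a' b', Reach (n+1) (joinConf s a b) (joinConf s a' b') ∧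
      ∑ v, a' v = ∑ v, a v + k ∧ ∑ v, b' v + 2 * k = ∑ v, b v ∧
      ∑ v, b' v % 2 = ∑ v, b v % 2 := by
  induction k with
  | zero => exact fun a b _ => ⟨a, b, .refl, by simp, by simp, rfl⟩
  | succ k ih =>
    intro a b h
    have hv : ∃ v, 2 ≤ b v := by
      by_contra! hc
      have : ∑ v, b v = ∑ v, b v % 2 :=
        Finset.sum_congr rfl (fun v _ => (Nat.mod_eq_of_lt (hc v)).symm)
      omega
    obtain ⟨v, hv⟩ := hv
    have s1 := sum_upd (Function.update a v (a v + 1)) a v (fun x hx => by simp [hx])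
    have s2 := sum_upd (Function.update b v (b v - 2)) b v (fun x hx => by simp [hx])
    have s3 := sum_upd (fun x => Function.update b v (b v - 2) x % 2) (fun x => b x % 2) v
      (fun x hx => by simp [hx])
    simp only [Function.update_self] at s1 s2 s3
    obtain ⟨a', b', hr, h1, h2, h3⟩ := ih (Function.update a v (a v + 1))
      (Function.update b v (b v - 2)) (by omega)
    exact ⟨a', b', Relation.ReflTransGen.head (move_cross s a b v hv) hr,
      by omega, by omega, by omega⟩

/-- Chung's induction: the cube has pebbling number at most `2 ^ n` and
the (odd) two-pebbling property. -/
theorem chung (n : ℕ) :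
    (∀ (r : Fin n → Bool) (p : (Fin n → Bool) → ℕ), 2 ^ n ≤ ∑ v, p v →
      ∃ q, Reach n p q ∧ 1 ≤ q r) ∧
    (∀ (r : Fin n → Bool) (p : (Fin n → Bool) → ℕ), 2 * 2 ^ n < ∑ v, p v + ∑ v, p v % 2 →
      ∃ q, Reach n p q ∧ 2 ≤ q r) := by
  induction n with
  | zero =>
    constructor
    · intro r p h
      refine ⟨p, .refl, ?_⟩
      rw [Fintype.sum_subsingleton _ r] at h
      simpa using h
    · intro r p h
      refine ⟨p, .refl, ?_⟩
      rw [Fintype.sum_subsingleton _ r, Fintype.sum_subsingleton _ r] at h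
      simp only [pow_zero] at h
      omega
  | succ n ih =>
    obtain ⟨ih1, ih2⟩ := ih
    have key : ∀ (s : Bool) (r : Fin n → Bool) (a b : (Fin n → Bool) → ℕ) (k : ℕ),
        k ≤ a r → 2 ≤ b r → ∃ q, Reach (n+1) (joinConf s a b) q ∧
          k + 1 ≤ q (Fin.cons s r) := by
      intro s r a b k ha hb
      refine ⟨_, .single (move_cross s a b r hb), ?_⟩
      simpa [joinConf] using ha
    constructor
    · intro r p h
      induction r using Fin.consCases with
      | _ s r =>
      have hs := sum_split s p
      rw [joinConf_split s p]
      rw [hs, pow_succ] at h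
      clear hs
      generalize ha : (fun u => p (Fin.cons s u)) = a
      generalize hb : (fun u => p (Fin.cons (!s) u)) = b
      have h : 2 ^ n * 2 ≤ ∑ v, a v + ∑ v, b v := by
        rw [← ha, ← hb]; exact h
      clear ha hb
      by_cases hc : ∑ v, a v < ∑ v, b v % 2
      · obtain ⟨b', hb, hb2⟩ := ih2 r b (by omega)
        obtain ⟨q, hq, hq1⟩ := key s r a b' 0 (by omega) hb2
        exact ⟨q, (reach_right s a hb).trans hq, hq1⟩
      · by_cases hN : 2 ^ n ≤ ∑ v, a v
        · obtain ⟨a', ha, ha1⟩ := ih1 r a hN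
          exact ⟨_, reach_left s b ha, by simpa [joinConf] using ha1⟩
        · obtain ⟨a', b', hr, h1, h2, h3⟩ := transfer s (2 ^ n - ∑ v, a v) a b (by omega)
          obtain ⟨a2, ha, ha1⟩ := ih1 r a' (by omega)
          exact ⟨_, hr.trans (reach_left s b' ha), by simpa [joinConf] using ha1⟩
    · intro r p h
      induction r using Fin.consCases with
      | _ s r =>
      have hs := sum_split s p
      have hs2 := sum_split s (fun x => p x % 2)
      rw [joinConf_split s p]
      rw [hs, hs2, pow_succ] at h
      clear hs hs2
      generalize ha : (fun u => p (Fin.cons s u)) = a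
      generalize hb : (fun u => p (Fin.cons (!s) u)) = b
      have h : 2 * (2 ^ n * 2) < ∑ v, a v + ∑ v, b v + (∑ v, a v % 2 + ∑ v, b v % 2) := by
        rw [← ha, ← hb]; exact h
      clear ha hb
      have hle : ∑ v, a v % 2 ≤ ∑ v, a v := Finset.sum_le_sum (fun v _ => Nat.mod_le _ _)
      have hcard : ∑ v, b v % 2 ≤ 2 ^ n := by
        calc ∑ v, b v % 2 ≤ ∑ v : Fin n → Bool, 1 := Finset.sum_le_sum (fun v _ => by omega)
          _ = 2 ^ n := by simp
      by_cases hc : 2 * 2 ^ n < ∑ v, a v + ∑ v, a v % 2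
      · obtain ⟨a', ha, ha1⟩ := ih2 r a hc
        exact ⟨_, reach_left s b ha, by simpa [joinConf] using ha1⟩
      · have fin : ∀ a b : (Fin n → Bool) → ℕ, 2 ^ n ≤ ∑ v, a v →
            2 * 2 ^ n < ∑ v, b v + ∑ v, b v % 2 →
            ∃ q, Reach (n+1) (joinConf s a b) q ∧ 2 ≤ q (Fin.cons s r) := by
          intro a b h1 h2
          obtain ⟨a', ha, ha1⟩ := ih1 r a h1
          obtain ⟨b', hb, hb1⟩ := ih2 r b h2
          obtain ⟨q, hq, hq1⟩ := key s r a' b' 1 ha1 hb1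
          exact ⟨q, ((reach_left s b ha).trans (reach_right s a' hb)).trans hq, hq1⟩
        by_cases hN : 2 ^ n ≤ ∑ v, a v
        · exact fin a b hN (by omega)
        · obtain ⟨a', b', hr, h1, h2, h3⟩ := transfer s (2 ^ n - ∑ v, a v) a b (by omega)
          obtain ⟨q, hq, hq1⟩ := fin a' b' (by omega) (by omega)
          exact ⟨q, hr.trans hq, hq1⟩

theorem stmt11 : pebblingNumber (cubeGraph 4) = 16 := by
  unfold pebblingNumber
  apply le_antisymm
  · apply Nat.sInf_le
    intro r p h
    exact (chung 4).1 r p h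
  · refine le_csInf ⟨16, fun r p h => (chung 4).1 r p h⟩ ?_
    intro N hN
    by_contra hlt
    have hsum : ∑ v : Fin 4 → Bool, (if v = fun _ => false then 0 else 1) = 15 := by decide
    obtain ⟨q, hq, hq1⟩ := hN (fun _ => false) (fun v => if v = fun _ => false then 0 else 1)
      (by rw [hsum]; omega)
    rcases Relation.ReflTransGen.cases_head hq with h | ⟨c, ⟨u, v, _, h2, _⟩, _⟩
    · rw [← h] at hq1
      simp at hq1
    · dsimp only at h2
      split_ifs at h2 <;> omega
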